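/- For α, β > -1 and m ≥ 1, the polynomial t ↦ P_m^{(α,β+1)}(1)·P_m^{(α+1,β)}(2t²-1) + P_m^{(α+1,β)}(1)·P_m^{(α,β+1)}(2t²-1) has 2m simple zeros inside (-1,1). -/

import Mathlib

open Real MeasureTheory

noncomputable def genBinom (a : ℝ) (k : ℕ) : ℝ :=
  (∏ i ∈ Finset.range k, (a - i)) / (Nat.factorial k : ℝ)

/-- The Jacobi polynomial `P_m^{(α,β)}` evaluated at `x`, via the standard
explicit formula `P_m^{(α,β)}(x) = ∑_{s=0}^m C(m+α, m-s) C(m+β, s) ((x-1)/2)^s ((x+1)/2)^{m-s}`. -/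
noncomputable def jacobiP (m : ℕ) (α β x : ℝ) : ℝ :=
  ∑ s ∈ Finset.range (m + 1),
    genBinom (α + m) (m - s) * genBinom (β + m) s * ((x - 1) / 2) ^ s * ((x + 1) / 2) ^ (m - s)

lemma rolle_fin (f f' : ℝ → ℝ) (S : Set ℝ) (hS : S.OrdConnected) (hS1 : S ⊆ Set.Icc 0 1)
    (hc : ContinuousOn f S) (hd : ∀ x ∈ Set.Ioo (0:ℝ) 1, HasDerivAt f (f' x) x)
    (n : ℕ) (Z : Finset ℝ) (hZ : Z.card = n + 1) (hZS : ∀ z ∈ Z, z ∈ S ∧ f z = 0) :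
    ∃ Y : Finset ℝ, Y.card = n ∧ ∀ y ∈ Y, y ∈ Set.Ioo (0:ℝ) 1 ∧ f' y = 0 := by
  classical
  let e := Z.orderEmbOfFin hZ
  have he : ∀ i, e i ∈ Z := fun i => Z.orderEmbOfFin_mem hZ i
  have key : ∀ i : Fin n, ∃ y, e i.castSucc < y ∧ y < e i.succ ∧ y ∈ Set.Ioo (0:ℝ) 1 ∧ f' y = 0 := by
    intro i
    have hlt : e i.castSucc < e i.succ := e.strictMono (Fin.castSucc_lt_succ)
    obtain ⟨a1, a2⟩ := hZS _ (he i.castSucc)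
    obtain ⟨b1, b2⟩ := hZS _ (he i.succ)
    have h01 : ∀ x ∈ Set.Ioo (e i.castSucc) (e i.succ), x ∈ Set.Ioo (0:ℝ) 1 := fun x hx =>
      ⟨(hS1 a1).1.trans_lt hx.1, hx.2.trans_le (hS1 b1).2⟩
    obtain ⟨y, hy, hy0⟩ := exists_hasDerivAt_eq_zero (f' := f') hlt (hc.mono (hS.out a1 b1))
      (a2.trans b2.symm) (fun x hx => hd x (h01 x hx))
    exact ⟨y, hy.1, hy.2, h01 y hy, hy0⟩
  choose g hg1 hg2 hg3 hg4 using key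
  have hmono : StrictMono g := by
    intro i j hij
    calc g i < e i.succ := hg2 i
      _ ≤ e j.castSucc := e.monotone (by
          rw [Fin.le_def]; simpa using hij)
      _ < g j := hg1 j
  refine ⟨Finset.univ.map ⟨g, hmono.injective⟩, by simp, ?_⟩
  intro y hy
  simp only [Finset.mem_map, Finset.mem_univ, true_and, Function.Embedding.coeFn_mk] at hy
  obtain ⟨i, rfl⟩ := hy
  exact ⟨hg3 i, hg4 i⟩

/-- normalized Jacobi coefficient -/
noncomputable def jc (m : ℕ) (a b : ℝ) (s : ℕ) : ℝ :=
  (m.choose s : ℝ) / (Real.Gamma (a + s) * Real.Gamma (b + m - s))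

noncomputable def jF (m : ℕ) (a b v : ℝ) : ℝ :=
  ∑ s ∈ Finset.range (m + 1),
    jc m a b s * (-1) ^ s * ((1 - v) ^ (a + s - 1) * v ^ (b + m - s - 1))

lemma jF_deriv (m : ℕ) (a b : ℝ) (ha : 0 < a) (hb : 0 < b) (v : ℝ) (hv : v ∈ Set.Ioo (0:ℝ) 1) :
    HasDerivAt (jF m (a + 1) (b + 1)) (- jF (m + 1) a b v) v := by
  obtain ⟨h0, h1⟩ := hv
  have h1' : 0 < 1 - v := by linarith
  have hder : HasDerivAt (jF m (a + 1) (b + 1)) (∑ s ∈ Finset.range (m + 1),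
      jc m (a+1) (b+1) s * (-1) ^ s *
        ((-1 * (a + 1 + s - 1) * (1 - v) ^ (a + 1 + s - 1 - 1)) * v ^ (b + 1 + m - s - 1)
        + (1 - v) ^ (a + 1 + s - 1) * (1 * (b + 1 + m - s - 1) * v ^ (b + 1 + m - s - 1 - 1)))) v := by
    unfold jF
    apply HasDerivAt.fun_sum
    intro s _
    apply HasDerivAt.const_mul
    apply HasDerivAt.mul
    · exact ((hasDerivAt_id v).const_sub 1).rpow_const (Or.inl h1'.ne')
    · exact (hasDerivAt_id v).rpow_const (Or.inl h0.ne')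
  convert hder using 1
  set U : ℕ → ℝ := fun s => (-1) ^ s * ((1 - v) ^ (a + s - 1) * v ^ (b + (m+1) - s - 1)) /
    (Real.Gamma (a + s) * Real.Gamma (b + (m+1) - s)) with hU
  have e1 : jF (m+1) a b v = ∑ s ∈ Finset.range (m + 1 + 1), ((m+1).choose s : ℝ) * U s := by
    unfold jF jc
    refine Finset.sum_congr rfl fun s _ => ?_
    simp only [hU]; push_cast; ring
  have e2 : ∀ s ∈ Finset.range (m+1), jc m (a+1) (b+1) s * (-1) ^ s *
        ((-1 * (a + 1 + s - 1) * (1 - v) ^ (a + 1 + s - 1 - 1)) * v ^ (b + 1 + m - s - 1)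
        + (1 - v) ^ (a + 1 + s - 1) * (1 * (b + 1 + m - s - 1) * v ^ (b + 1 + m - s - 1 - 1)))
        = - ((m.choose s : ℝ) * U s + (m.choose s : ℝ) * U (s+1)) := by
    intro s hs
    have hsm : (s:ℝ) ≤ m := by
      have := Finset.mem_range.1 hs
      exact_mod_cast Nat.lt_succ_iff.1 this
    have hs0 : (0:ℝ) ≤ s := Nat.cast_nonneg s
    have g1 : Real.Gamma (a + 1 + s) = (a + s) * Real.Gamma (a + s) := by
      rw [← Real.Gamma_add_one (by linarith)]; congr 1; ring
    have g2 : Real.Gamma (b + 1 + m - s) = (b + m - s) * Real.Gamma (b + m - s) := by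
      rw [← Real.Gamma_add_one (by linarith)]; congr 1; ring
    have p1 : 0 < Real.Gamma (a + s) := Real.Gamma_pos_of_pos (by linarith)
    have p2 : 0 < Real.Gamma (b + m - s) := Real.Gamma_pos_of_pos (by linarith)
    have q1 : 0 < a + s := by linarith
    have q2 : 0 < b + m - s := by linarith
    simp only [hU, jc]
    push_cast
    rw [show a + ((s:ℝ) + 1) = a + 1 + s by ring, show b + ((m:ℝ) + 1) - (s + 1) = b + m - s by ring,
      show b + ((m:ℝ) + 1) - s = b + 1 + m - s by ring, g1, g2,
      show a + 1 + (s:ℝ) - 1 = a + s by ring, show b + 1 + (m:ℝ) - s - 1 = b + m - s by ring]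
    generalize (1 - v) ^ (a + (s:ℝ)) = x1
    generalize (1 - v) ^ (a + (s:ℝ) - 1) = x2
    generalize v ^ (b + (m:ℝ) - s) = x3
    generalize v ^ (b + (m:ℝ) - s - 1) = x4
    generalize Real.Gamma (a + s) = G1 at *
    generalize Real.Gamma (b + m - s) = G2 at *
    generalize a + (s:ℝ) = A at *
    generalize b + (m:ℝ) - s = B at *
    rw [pow_succ]
    field_simp
    ring
  rw [Finset.sum_congr rfl e2, e1, Finset.sum_neg_distrib, Finset.sum_add_distrib]
  congr 1
  rw [Finset.sum_range_succ', Finset.sum_congr rfl (fun s _ => by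
    rw [Nat.choose_succ_succ, Nat.cast_add, add_mul])]
  rw [Finset.sum_add_distrib]
  have := Finset.sum_range_succ' (fun s => (m.choose s : ℝ) * U s) (m+1)
  rw [Finset.sum_range_succ] at this
  simp at this ⊢
  linarith

lemma jF_zeros (m : ℕ) : ∀ (a b : ℝ), 0 < a → 0 < b →
    ∃ Y : Finset ℝ, Y.card = m ∧ ∀ y ∈ Y, y ∈ Set.Ioo (0:ℝ) 1 ∧ jF m a b y = 0 := by
  classical
  induction m with
  | zero => intro a b _ _; exact ⟨∅, by simp, by simp⟩
  | succ m ih =>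
    intro a b ha hb
    obtain ⟨Y, hY, hY0⟩ := ih (a+1) (b+1) (by linarith) (by linarith)
    have hn0 : (0:ℝ) ∉ Y := fun h => lt_irrefl _ (hY0 0 h).1.1
    have hn1 : (1:ℝ) ∉ Y := fun h => lt_irrefl _ (hY0 1 h).1.2
    have hex : ∀ s ∈ Finset.range (m+1), 0 < a + 1 + (s:ℝ) - 1 ∧ 0 < b + 1 + (m:ℝ) - s - 1 := by
      intro s hs
      have hsm : (s:ℝ) ≤ m := by
        have := Finset.mem_range.1 hs
        exact_mod_cast Nat.lt_succ_iff.1 this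
      have hs0 : (0:ℝ) ≤ s := Nat.cast_nonneg s
      constructor <;> linarith
    obtain ⟨Z, hZ, hZ0⟩ := rolle_fin (jF m (a+1) (b+1)) (fun v => - jF (m+1) a b v) (Set.Icc 0 1)
      Set.ordConnected_Icc le_rfl (by
        unfold jF
        apply continuousOn_finsetSum
        intro s hs
        obtain ⟨k1, k2⟩ := hex s hs
        apply Continuous.continuousOn
        apply Continuous.mul continuous_const
        apply Continuous.mul
        · exact (continuous_const.sub continuous_id).rpow_const (fun _ => Or.inr k1.le)
        · exact continuous_id.rpow_const (fun _ => Or.inr k2.le))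
      (fun v hv => jF_deriv m a b ha hb v hv) (m+1) (insert 0 (insert 1 Y))
      (by rw [Finset.card_insert_of_notMem (by simp [hn0]), Finset.card_insert_of_notMem hn1, hY])
      (by
        intro z hz
        simp only [Finset.mem_insert] at hz
        rcases hz with rfl | rfl | hz
        · refine ⟨by simp, Finset.sum_eq_zero fun s hs => ?_⟩
          rw [Real.zero_rpow (hex s hs).2.ne']; ring
        · refine ⟨by simp, Finset.sum_eq_zero fun s hs => ?_⟩
          rw [sub_self, Real.zero_rpow (hex s hs).1.ne']; ring
        · exact ⟨Set.Ioo_subset_Icc_self (hY0 z hz).1, (hY0 z hz).2⟩)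
    exact ⟨Z, hZ, fun y hy => ⟨(hZ0 y hy).1, neg_eq_zero.1 (hZ0 y hy).2⟩⟩

/-- multiplier step -/
lemma mult_zeros (m : ℕ) (c : ℕ → ℝ) (p q : ℝ) (hp : 0 < p) (hq : 0 < p + m * q)
    (Y : Finset ℝ) (hY : Y.card = m) (hY0 : ∀ y ∈ Y, y ∈ Set.Ioo (0:ℝ) 1 ∧
      ∑ s ∈ Finset.range (m + 1), c s * ((y - 1) ^ s * y ^ (m - s)) = 0) :
    ∃ Z : Finset ℝ, Z.card = m ∧ ∀ y ∈ Z, y ∈ Set.Ioo (0:ℝ) 1 ∧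
      ∑ s ∈ Finset.range (m + 1), (p + s * q) * c s * ((y - 1) ^ s * y ^ (m - s)) = 0 := by
  classical
  have hn0 : (0:ℝ) ∉ Y := fun h => lt_irrefl _ (hY0 0 h).1.1
  have hn1 : (1:ℝ) ∉ Y := fun h => lt_irrefl _ (hY0 1 h).1.2
  rcases eq_or_ne q 0 with rfl | hq0
  · refine ⟨Y, hY, fun y hy => ⟨(hY0 y hy).1, ?_⟩⟩
    have := (hY0 y hy).2
    simp only [mul_zero, add_zero, mul_assoc]
    rw [← Finset.mul_sum, this, mul_zero]
  set l := p / q with hl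
  set H : ℝ → ℝ := fun v => ∑ s ∈ Finset.range (m+1),
    c s * (-1) ^ s * ((1 - v) ^ (l + s) * v ^ (-(l + s))) with hH
  set Q : ℝ → ℝ := fun y =>
    ∑ s ∈ Finset.range (m + 1), (p + s * q) * c s * ((y - 1) ^ s * y ^ (m - s)) with hQ
  have rp : ∀ v ∈ Set.Ioo (0:ℝ) 1, ∀ s ∈ Finset.range (m+1), ∀ k : ℝ,
      (-1) ^ s * ((1 - v) ^ (l + s - k) * v ^ (-(l + s) - k))
        = ((1 - v) ^ (l - k) * v ^ (-l - m - k)) * ((v - 1) ^ s * v ^ (m - s)) := by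
    intro v hv s hs k
    have h1 : 0 < 1 - v := by linarith [hv.2]
    have hsm : s ≤ m := Nat.lt_succ_iff.1 (Finset.mem_range.1 hs)
    rw [show l + (s:ℝ) - k = (l - k) + s by ring, Real.rpow_add_natCast h1.ne',
      show -(l + (s:ℝ)) - k = (-l - m - k) + ((m - s : ℕ) : ℝ) by push_cast [hsm]; ring,
      Real.rpow_add_natCast hv.1.ne', show v - 1 = (-1) * (1 - v) by ring, mul_pow]
    ring
  have hHz : ∀ y ∈ Y, H y = 0 := by
    intro y hy
    obtain ⟨h1, h2⟩ := hY0 y hy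
    have : H y = ((1 - y) ^ (l - 0) * y ^ (-l - m - 0)) *
        ∑ s ∈ Finset.range (m + 1), c s * ((y - 1) ^ s * y ^ (m - s)) := by
      rw [Finset.mul_sum]
      refine Finset.sum_congr rfl fun s hs => ?_
      have := rp y h1 s hs 0
      rw [sub_zero, sub_zero] at this
      rw [mul_assoc, this]; ring
    rw [this, h2, mul_zero]
  have hHd : ∀ v ∈ Set.Ioo (0:ℝ) 1, HasDerivAt H
      (-(1 / q) * ((1 - v) ^ (l - 1) * v ^ (-l - m - 1)) * Q v) v := by
    intro v hv
    have h1 : 0 < 1 - v := by linarith [hv.2]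
    have hder : HasDerivAt H (∑ s ∈ Finset.range (m + 1), c s * (-1) ^ s *
        ((-1 * (l + s) * (1 - v) ^ (l + s - 1)) * v ^ (-(l + s))
        + (1 - v) ^ (l + s) * (1 * (-(l + s)) * v ^ (-(l + s) - 1)))) v := by
      simp only [hH]
      apply HasDerivAt.fun_sum
      intro s _
      apply HasDerivAt.const_mul
      apply HasDerivAt.mul
      · exact ((hasDerivAt_id v).const_sub 1).rpow_const (Or.inl h1.ne')
      · exact (hasDerivAt_id v).rpow_const (Or.inl hv.1.ne')
    convert hder using 1
    simp only [hQ]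
    rw [Finset.mul_sum]
    refine Finset.sum_congr rfl fun s hs => ?_
    have e1 : (1 - v) ^ (l + s) = (1 - v) ^ (l + s - 1) * (1 - v) := by
      rw [← Real.rpow_add_one h1.ne']; congr 1; ring
    have e2 : v ^ (-(l + s)) = v ^ (-(l + s) - 1) * v := by
      rw [← Real.rpow_add_one hv.1.ne']; congr 1; ring
    have e3 := rp v hv s hs 1
    have e4 : p + s * q = q * (l + s) := by rw [hl]; field_simp
    rw [e1, e2, e4]
    have : c s * (-1) ^ s * (-1 * (l + ↑s) * (1 - v) ^ (l + ↑s - 1) * (v ^ (-(l + ↑s) - 1) * v) +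
      (1 - v) ^ (l + ↑s - 1) * (1 - v) * (1 * -(l + ↑s) * v ^ (-(l + ↑s) - 1)))
      = - c s * (l + s) * ((-1) ^ s * ((1 - v) ^ (l + s - 1) * v ^ (-(l + s) - 1))) := by ring
    rw [this, e3]
    field_simp
  have fin : ∀ Z : Finset ℝ, (Z.card = m ∧ ∀ y ∈ Z, y ∈ Set.Ioo (0:ℝ) 1 ∧
      -(1 / q) * ((1 - y) ^ (l - 1) * y ^ (-l - m - 1)) * Q y = 0) →
      (Z.card = m ∧ ∀ y ∈ Z, y ∈ Set.Ioo (0:ℝ) 1 ∧ Q y = 0) := by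
    rintro Z ⟨h1, h2⟩
    refine ⟨h1, fun y hy => ⟨(h2 y hy).1, ?_⟩⟩
    obtain ⟨⟨h3, h4⟩, h5⟩ := h2 y hy
    have k1 : 0 < (1 - y) ^ (l - 1) := Real.rpow_pos_of_pos (by linarith) _
    have k2 : 0 < y ^ (-l - m - 1) := Real.rpow_pos_of_pos h3 _
    have k3 : -(1 / q) ≠ 0 := by simpa using hq0
    exact (mul_eq_zero.1 h5).resolve_left (mul_ne_zero k3 (mul_pos k1 k2).ne')
  rcases lt_or_gt_of_ne hq0 with hneg | hpos
  · have hll : ∀ s ∈ Finset.range (m+1), l + (s:ℝ) < 0 := by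
      intro s hs
      have hsm : (s:ℝ) ≤ m := by
        have := Finset.mem_range.1 hs
        exact_mod_cast Nat.lt_succ_iff.1 this
      have : l + m < 0 := by
        have : l + m = (p + m * q) / q := by rw [hl]; field_simp
        rw [this]; exact div_neg_of_pos_of_neg hq hneg
      linarith
    obtain ⟨Z, hZ⟩ := rolle_fin H _ (Set.Ico 0 1) Set.ordConnected_Ico Set.Ico_subset_Icc_self
      (by
        simp only [hH]
        apply continuousOn_finsetSum
        intro s hs
        apply ContinuousOn.mul continuousOn_const
        apply ContinuousOn.mul
        · exact (continuousOn_const.sub continuousOn_id).rpow_const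
            (fun x hx => Or.inl (by have := hx.2; exact (sub_pos.2 this).ne'))
        · exact continuousOn_id.rpow_const (fun _ _ => Or.inr (by linarith [hll s hs])))
      hHd m (insert 0 Y) (by rw [Finset.card_insert_of_notMem hn0, hY])
      (by
        intro z hz
        simp only [Finset.mem_insert] at hz
        rcases hz with rfl | hz
        · refine ⟨by simp, Finset.sum_eq_zero fun s hs => ?_⟩
          rw [Real.zero_rpow (by linarith [hll s hs])]; ring
        · exact ⟨Set.Ioo_subset_Ico_self (hY0 z hz).1, hHz z hz⟩)
    exact ⟨Z, fin Z hZ⟩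
  · have hll : ∀ s ∈ Finset.range (m+1), 0 < l + (s:ℝ) := by
      intro s hs
      have : 0 < l := div_pos hp hpos
      positivity
    obtain ⟨Z, hZ⟩ := rolle_fin H _ (Set.Ioc 0 1) Set.ordConnected_Ioc Set.Ioc_subset_Icc_self
      (by
        simp only [hH]
        apply continuousOn_finsetSum
        intro s hs
        apply ContinuousOn.mul continuousOn_const
        apply ContinuousOn.mul
        · exact (continuousOn_const.sub continuousOn_id).rpow_const
            (fun x hx => Or.inr (hll s hs).le)
        · exact continuousOn_id.rpow_const (fun x hx => Or.inl hx.1.ne'))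
      hHd m (insert 1 Y) (by rw [Finset.card_insert_of_notMem hn1, hY])
      (by
        intro z hz
        simp only [Finset.mem_insert] at hz
        rcases hz with rfl | hz
        · refine ⟨by simp, Finset.sum_eq_zero fun s hs => ?_⟩
          rw [sub_self, Real.zero_rpow (hll s hs).ne']; ring
        · exact ⟨Set.Ioo_subset_Ioc_self (hY0 z hz).1, hHz z hz⟩)
    exact ⟨Z, fin Z hZ⟩

lemma genBinom_gamma (a : ℝ) (k : ℕ) (h : 0 < a - k + 1) :
    genBinom a k = Real.Gamma (a + 1) / (k.factorial * Real.Gamma (a - k + 1)) := by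
  have key : ∀ k : ℕ, 0 < a - k + 1 →
      (∏ i ∈ Finset.range k, (a - i)) * Real.Gamma (a - k + 1) = Real.Gamma (a + 1) := by
    intro k
    induction k with
    | zero => intro _; simp
    | succ k ih =>
      intro h
      push_cast at h ⊢
      rw [Finset.prod_range_succ, ← ih (by linarith), Real.Gamma_add_one (s := a - k) (by linarith),
        show a - ((k:ℝ) + 1) + 1 = a - k by ring]
      ring
  have hg := Real.Gamma_pos_of_pos h
  have hk : (0:ℝ) < k.factorial := by exact_mod_cast k.factorial_pos
  rw [genBinom, ← key k h]
  field_simp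

lemma genBinom_coef (m s : ℕ) (hs : s ≤ m) (α β : ℝ) (hα : -1 < α) (hβ : -1 < β) :
    genBinom (α + m) (m - s) * genBinom (β + m) s =
      Real.Gamma (α + m + 1) * Real.Gamma (β + m + 1) / m.factorial * jc m (α + 1) (β + 1) s := by
  have hsm : (s:ℝ) ≤ m := by exact_mod_cast hs
  have hs0 : (0:ℝ) ≤ s := Nat.cast_nonneg s
  rw [genBinom_gamma _ _ (by push_cast [hs]; linarith), genBinom_gamma _ _ (by linarith), jc,
    Nat.cast_choose ℝ hs]
  push_cast [hs]
  rw [show α + m - ((m:ℝ) - s) + 1 = α + 1 + s by ring,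
    show β + m - (s:ℝ) + 1 = β + 1 + m - s by ring]
  have p1 : 0 < Real.Gamma (α + 1 + s) := Real.Gamma_pos_of_pos (by linarith)
  have p2 : 0 < Real.Gamma (β + 1 + m - s) := Real.Gamma_pos_of_pos (by linarith)
  have hk : (0:ℝ) < m.factorial := by exact_mod_cast m.factorial_pos
  field_simp

lemma jacobiP_one (m : ℕ) (α β : ℝ) : jacobiP m α β 1 = genBinom (α + m) m := by
  unfold jacobiP
  rw [Finset.sum_range_succ']
  simp [genBinom]

lemma jacobiP_sq (m : ℕ) (α β x : ℝ) (hα : -1 < α) (hβ : -1 < β) :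
    jacobiP m α β (2 * x ^ 2 - 1) =
    ∑ s ∈ Finset.range (m + 1),
      (Real.Gamma (α + m + 1) * Real.Gamma (β + m + 1) / m.factorial * jc m (α + 1) (β + 1) s) *
        ((x ^ 2 - 1) ^ s * (x ^ 2) ^ (m - s)) := by
  unfold jacobiP
  refine Finset.sum_congr rfl fun s hs => ?_
  rw [genBinom_coef m s (Nat.lt_succ_iff.1 (Finset.mem_range.1 hs)) α β hα hβ,
    show (2 * x ^ 2 - 1 - 1) / 2 = x ^ 2 - 1 by ring, show (2 * x ^ 2 - 1 + 1) / 2 = x ^ 2 by ring]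
  ring

lemma q_eq (m : ℕ) (α β : ℝ) (hα : -1 < α) (hβ : -1 < β) : ∃ E : ℝ, 0 < E ∧ ∀ x : ℝ,
    jacobiP m α (β + 1) 1 * jacobiP m (α + 1) β (2 * x ^ 2 - 1)
            + jacobiP m (α + 1) β 1 * jacobiP m α (β + 1) (2 * x ^ 2 - 1) =
    E * ∑ s ∈ Finset.range (m + 1),
      (2 * (α + 1) * (m + β + 1) + s * (m + β - α)) * jc m (α + 2) (β + 2) s *
        ((x ^ 2 - 1) ^ s * (x ^ 2) ^ (m - s)) := by
  have hm0 : (0:ℝ) ≤ m := Nat.cast_nonneg m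
  have hk : (0:ℝ) < m.factorial := by exact_mod_cast m.factorial_pos
  have G1 : 0 < Real.Gamma (α + m + 1) := Real.Gamma_pos_of_pos (by linarith)
  have G2 : 0 < Real.Gamma (β + m + 1) := Real.Gamma_pos_of_pos (by linarith)
  have G3 : 0 < Real.Gamma (α + 1) := Real.Gamma_pos_of_pos (by linarith)
  have G4 : 0 < Real.Gamma (α + 1 + m + 1) := Real.Gamma_pos_of_pos (by linarith)
  have ha : 0 < α + 1 := by linarith
  refine ⟨Real.Gamma (α + m + 1) * Real.Gamma (β + m + 1) * Real.Gamma (α + 1 + m + 1) /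
    (m.factorial ^ 2 * Real.Gamma (α + 1) * (α + 1)), by positivity, fun x => ?_⟩
  rw [jacobiP_one, jacobiP_one, jacobiP_sq _ _ _ _ (by linarith) hβ,
    jacobiP_sq _ _ _ _ hα (by linarith), genBinom_gamma _ _ (by linarith),
    genBinom_gamma _ _ (by linarith), Finset.mul_sum, Finset.mul_sum, Finset.mul_sum,
    ← Finset.sum_add_distrib]
  refine Finset.sum_congr rfl fun s hs => ?_
  have hsm : (s:ℝ) ≤ m := by
    have := Finset.mem_range.1 hs
    exact_mod_cast Nat.lt_succ_iff.1 this
  have hs0 : (0:ℝ) ≤ s := Nat.cast_nonneg s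
  have r1 : Real.Gamma (α + 2 + s) = (α + 1 + s) * Real.Gamma (α + 1 + s) := by
    rw [← Real.Gamma_add_one (by linarith)]; congr 1; ring
  have r2 : Real.Gamma (β + 2 + m - s) = (β + 1 + m - s) * Real.Gamma (β + 1 + m - s) := by
    rw [← Real.Gamma_add_one (by linarith)]; congr 1; ring
  have r3 : Real.Gamma (α + 1 + m - m + 1) = (α + 1) * Real.Gamma (α + 1) := by
    rw [← Real.Gamma_add_one (by linarith)]; congr 1; ring
  have r4 : Real.Gamma (β + 1 + m + 1) = (β + m + 1) * Real.Gamma (β + m + 1) := by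
    rw [← Real.Gamma_add_one (by linarith)]; congr 1; ring
  have p1 : 0 < Real.Gamma (α + 1 + s) := Real.Gamma_pos_of_pos (by linarith)
  have p2 : 0 < Real.Gamma (β + 1 + m - s) := Real.Gamma_pos_of_pos (by linarith)
  have q1 : 0 < α + 1 + s := by linarith
  have q2 : 0 < β + 1 + m - s := by linarith
  simp only [jc]
  rw [show α + 1 + 1 = α + 2 by ring, show β + 1 + 1 = β + 2 by ring, r1, r2, r3, r4,
    show α + m - (m:ℝ) + 1 = α + 1 by ring]
  field_simp
  ring

/-- A nonzero polynomial of degree at most `N` with `N` distinct roots. -/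
lemma simple_of_card (P : Polynomial ℝ) (N : ℕ) (hP : P ≠ 0) (hN : P.natDegree ≤ N)
    (Z : Finset ℝ) (hZ : Z.card = N) (hZ0 : ∀ z ∈ Z, P.eval z = 0) :
    (∀ t, P.eval t = 0 → t ∈ Z) ∧ ∀ t ∈ Z, P.derivative.eval t ≠ 0 := by
  have hle : Z.val ≤ P.roots := by
    rw [Multiset.le_iff_subset Z.nodup]
    intro z hz
    exact (Polynomial.mem_roots hP).2 (hZ0 z hz)
  have heq : Z.val = P.roots := Multiset.eq_of_le_of_card_le hle
    ((Polynomial.card_roots' P).trans (hN.trans hZ.symm.le))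
  refine ⟨fun t ht => ?_, fun t ht hd => ?_⟩
  · rw [← Finset.mem_val, heq]; exact (Polynomial.mem_roots hP).2 ht
  · have h1 : 1 < P.rootMultiplicity t :=
      (Polynomial.one_lt_rootMultiplicity_iff_isRoot hP).2 ⟨hZ0 t ht, hd⟩
    have h2 : P.roots.count t ≤ 1 := Multiset.nodup_iff_count_le_one.1 (heq ▸ Z.nodup) t
    rw [Polynomial.count_roots] at h2
    omega

theorem two_m_simple_zeros
    (α β : ℝ) (hα : -1 < α) (hβ : -1 < β) (m : ℕ) (hm : 1 ≤ m) :
    ∃ Z : Finset ℝ, Z.card = 2 * m ∧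
      (∀ t ∈ Z, t ∈ Set.Ioo (-1 : ℝ) 1 ∧
        (fun x : ℝ => jacobiP m α (β + 1) 1 * jacobiP m (α + 1) β (2 * x ^ 2 - 1)
            + jacobiP m (α + 1) β 1 * jacobiP m α (β + 1) (2 * x ^ 2 - 1)) t = 0 ∧
        deriv (fun x : ℝ => jacobiP m α (β + 1) 1 * jacobiP m (α + 1) β (2 * x ^ 2 - 1)
            + jacobiP m (α + 1) β 1 * jacobiP m α (β + 1) (2 * x ^ 2 - 1)) t ≠ 0) ∧
      (∀ t ∈ Set.Ioo (-1 : ℝ) 1,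
        jacobiP m α (β + 1) 1 * jacobiP m (α + 1) β (2 * t ^ 2 - 1)
            + jacobiP m (α + 1) β 1 * jacobiP m α (β + 1) (2 * t ^ 2 - 1) = 0 → t ∈ Z) := by
  classical
  have hm0 : (0:ℝ) ≤ m := Nat.cast_nonneg m
  obtain ⟨Y, hY, hY0⟩ := jF_zeros m (α + 2) (β + 2) (by linarith) (by linarith)
  have hY1 : ∀ y ∈ Y, y ∈ Set.Ioo (0:ℝ) 1 ∧
      ∑ s ∈ Finset.range (m + 1), jc m (α + 2) (β + 2) s * ((y - 1) ^ s * y ^ (m - s)) = 0 := by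
    intro y hy
    obtain ⟨h1, h2⟩ := hY0 y hy
    refine ⟨h1, ?_⟩
    have h1' : 0 < 1 - y := by linarith [h1.2]
    have e : jF m (α + 2) (β + 2) y = ((1 - y) ^ (α + 1) * y ^ (β + 1)) *
        ∑ s ∈ Finset.range (m + 1), jc m (α + 2) (β + 2) s * ((y - 1) ^ s * y ^ (m - s)) := by
      unfold jF
      rw [Finset.mul_sum]
      refine Finset.sum_congr rfl fun s hs => ?_
      have hsm : s ≤ m := Nat.lt_succ_iff.1 (Finset.mem_range.1 hs)
      rw [show α + 2 + (s:ℝ) - 1 = (α + 1) + s by ring, Real.rpow_add_natCast h1'.ne',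
        show β + 2 + (m:ℝ) - s - 1 = (β + 1) + ((m - s : ℕ) : ℝ) by push_cast [hsm]; ring,
        Real.rpow_add_natCast h1.1.ne', show y - 1 = (-1) * (1 - y) by ring, mul_pow]
      ring
    rw [e] at h2
    exact (mul_eq_zero.1 h2).resolve_left
      (mul_pos (Real.rpow_pos_of_pos h1' _) (Real.rpow_pos_of_pos h1.1 _)).ne'
  have ha : 0 < α + 1 := by linarith
  have hb : 0 < m + β + 1 := by linarith
  have hb1 : 0 < β + 1 := by linarith
  have hpos : 0 < 2 * (α + 1) * (m + β + 1) + m * (m + β - α) := by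
    have e : 2 * (α + 1) * (m + β + 1) + m * (m + β - α)
      = 2 * (α + 1) * (β + 1) + (α + 1) * m + m * (m + β + 1) := by ring
    rw [e]; positivity
  obtain ⟨V, hV, hV0⟩ := mult_zeros m _ (2 * (α + 1) * (m + β + 1)) (m + β - α)
    (by positivity) hpos Y hY hY1
  obtain ⟨E, hE, hq⟩ := q_eq m α β hα hβ
  set P : Polynomial ℝ := Polynomial.C E * ∑ s ∈ Finset.range (m + 1),
      Polynomial.C ((2 * (α + 1) * (m + β + 1) + s * (m + β - α)) * jc m (α + 2) (β + 2) s) *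
        ((Polynomial.X ^ 2 - Polynomial.C 1) ^ s * (Polynomial.X ^ 2) ^ (m - s)) with hPdef
  have hPe : ∀ x, P.eval x = jacobiP m α (β + 1) 1 * jacobiP m (α + 1) β (2 * x ^ 2 - 1)
            + jacobiP m (α + 1) β 1 * jacobiP m α (β + 1) (2 * x ^ 2 - 1) := by
    intro x
    rw [hq, hPdef]
    simp [Polynomial.eval_finsetSum]
  have hfun : (fun x : ℝ => jacobiP m α (β + 1) 1 * jacobiP m (α + 1) β (2 * x ^ 2 - 1)
            + jacobiP m (α + 1) β 1 * jacobiP m α (β + 1) (2 * x ^ 2 - 1)) = fun x => P.eval x :=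
    funext fun x => (hPe x).symm
  have hP0 : P ≠ 0 := by
    intro h
    have h1 := hPe 1
    rw [h, Polynomial.eval_zero, show (2:ℝ) * 1 ^ 2 - 1 = 1 by norm_num, jacobiP_one, jacobiP_one,
      genBinom_gamma _ _ (by linarith), genBinom_gamma _ _ (by linarith)] at h1
    have hk : (0:ℝ) < m.factorial := by exact_mod_cast m.factorial_pos
    have G1 : 0 < Real.Gamma (α + m + 1) := Real.Gamma_pos_of_pos (by linarith)
    have G2 : 0 < Real.Gamma (α + m - m + 1) := Real.Gamma_pos_of_pos (by linarith)
    have G3 : 0 < Real.Gamma (α + 1 + m - m + 1) := Real.Gamma_pos_of_pos (by linarith)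
    have G4 : 0 < Real.Gamma (α + 1 + m + 1) := Real.Gamma_pos_of_pos (by linarith)
    have : 0 < Real.Gamma (α + m + 1) / (m.factorial * Real.Gamma (α + m - m + 1)) *
      (Real.Gamma (α + 1 + m + 1) / (m.factorial * Real.Gamma (α + 1 + m - m + 1))) := by positivity
    linarith
  have hdeg : P.natDegree ≤ 2 * m := by
    refine (Polynomial.natDegree_C_mul_le _ _).trans ?_
    refine Polynomial.natDegree_sum_le_of_forall_le _ _ fun s hs => ?_
    have hsm : s ≤ m := Nat.lt_succ_iff.1 (Finset.mem_range.1 hs)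
    refine (Polynomial.natDegree_C_mul_le _ _).trans ?_
    refine Polynomial.natDegree_mul_le.trans ?_
    have h1 := Polynomial.natDegree_pow_le_of_le s
      (Polynomial.natDegree_X_pow_sub_C (R := ℝ) (n := 2) (r := 1)).le
    have h2 := Polynomial.natDegree_pow_le_of_le (m - s)
      (Polynomial.natDegree_X_pow (R := ℝ) 2).le
    omega
  have inj1 : Set.InjOn Real.sqrt V := fun x hx y hy h =>
    (Real.sqrt_inj (hV0 x hx).1.1.le (hV0 y hy).1.1.le).1 h
  have inj2 : Set.InjOn (fun v => -Real.sqrt v) V := fun x hx y hy h =>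
    inj1 hx hy (neg_injective h)
  set Z : Finset ℝ := V.image Real.sqrt ∪ V.image (fun v => -Real.sqrt v) with hZdef
  have hZ : Z.card = 2 * m := by
    rw [hZdef, Finset.card_union_of_disjoint, Finset.card_image_of_injOn inj1,
      Finset.card_image_of_injOn inj2, hV]
    · ring
    · rw [Finset.disjoint_left]
      intro x h1 h2
      obtain ⟨a, ha, rfl⟩ := Finset.mem_image.1 h1
      obtain ⟨b, hb, hab⟩ := Finset.mem_image.1 h2
      have := Real.sqrt_pos.2 (hV0 a ha).1.1
      have := Real.sqrt_pos.2 (hV0 b hb).1.1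
      linarith
  have hZV : ∀ t ∈ Z, t ^ 2 ∈ V := by
    intro t ht
    rcases Finset.mem_union.1 ht with h | h
    · obtain ⟨a, ha, rfl⟩ := Finset.mem_image.1 h
      rwa [Real.sq_sqrt (hV0 a ha).1.1.le]
    · obtain ⟨a, ha, rfl⟩ := Finset.mem_image.1 h
      rwa [neg_sq, Real.sq_sqrt (hV0 a ha).1.1.le]
  have hroot : ∀ t ∈ Z, P.eval t = 0 := by
    intro t ht
    rw [hPe, hq, (hV0 _ (hZV t ht)).2, mul_zero]
  obtain ⟨c1, c2⟩ := simple_of_card P (2 * m) hP0 hdeg Z hZ hroot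
  refine ⟨Z, hZ, fun t ht => ⟨?_, ?_, ?_⟩, fun t _ h => c1 t ((hPe t).trans h)⟩
  · have := (hV0 _ (hZV t ht)).1.2
    exact abs_lt.1 ((sq_lt_one_iff_abs_lt_one t).1 this)
  · rw [hfun]; exact hroot t ht
  · rw [hfun, Polynomial.deriv]; exact c2 t ht
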